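/- There exists a sequence of real numbers (a_n)_{n ≥ 0} such that the power series f(x) = Σ_{n=0}^∞ a_n x^n converges for every real x, and: (1) a_n ∈ [−1,1] for every n ≥ 0; (2) the sequence (a_n) contains arbitrarily long strings of negative numbers, i.e. for every m ≥ 1 there exists N such that a_{N+i} < 0 for all 0 ≤ i ≤ m−1; (3) for every tree G, f_G[A] ∈ P_G for every A ∈ P_G([0,∞)). -/

import Mathlib

open Matrix
open scoped Classical ENNReal

/-- `A` has zeros according to the graph `G`: off-diagonal entries at non-edges vanish. -/
def sparsePattern {n : ℕ} (G : SimpleGraph (Fin n)) (A : Matrix (Fin n) (Fin n) ℝ) : Prop :=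
  ∀ i j, i ≠ j → ¬ G.Adj i j → A i j = 0

/-- `A ∈ P_G(I)`: `A` is positive semidefinite, has entries in `I`,
and has zeros according to `G`. -/
def memPG {n : ℕ} (G : SimpleGraph (Fin n)) (I : Set ℝ) (A : Matrix (Fin n) (Fin n) ℝ) : Prop :=
  A.PosSemidef ∧ (∀ i j, A i j ∈ I) ∧ sparsePattern G A

/-- The entrywise application `f_G[A]` of `f` to `A` according to the graph `G`. -/
noncomputable def applyG {n : ℕ} (G : SimpleGraph (Fin n)) (f : ℝ → ℝ)
    (A : Matrix (Fin n) (Fin n) ℝ) : Matrix (Fin n) (Fin n) ℝ :=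
  Matrix.of fun i j => if i = j ∨ G.Adj i j then f (A i j) else 0

/-- An acyclic graph with at least one edge has a vertex with exactly one neighbour. -/
lemma SimpleGraph.IsAcyclic.exists_existsUnique_adj {V : Type*} [Finite V] {G : SimpleGraph V}
    (hG : G.IsAcyclic) (hne : G ≠ ⊥) : ∃ v, ∃! u, G.Adj v u := by
  obtain ⟨a, b, hab⟩ := SimpleGraph.ne_bot_iff_exists_adj.mp hne
  have : Nonempty V := ⟨a⟩
  obtain ⟨u, v, p, hp, hmax⟩ := SimpleGraph.Walk.exists_isPath_forall_isPath_length_le_length G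
  have hpos : 1 ≤ p.length := by
    simpa using hmax _ _ (SimpleGraph.Walk.cons hab .nil) (by simp [hab.ne])
  have hnil : ¬ p.Nil := by
    intro h
    have := SimpleGraph.Walk.length_eq_zero_iff.mpr h
    omega
  refine ⟨v, p.penultimate, (p.adj_penultimate hnil).symm, fun w hw => ?_⟩
  refine hG.eq_penultimate_of_adj_end hp hw ?_
  by_contra hsupp
  have := hmax _ _ _ (hp.concat hsupp hw)
  simp at this

/-- Functions that are nonnegative, superadditive and multiplicatively midpoint convex
on `[0, ∞)`. -/
structure SuperMidconvex (f : ℝ → ℝ) : Prop where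
  nonneg : ∀ x, 0 ≤ x → 0 ≤ f x
  superadd : ∀ x y, 0 ≤ x → 0 ≤ y → f x + f y ≤ f (x + y)
  midconvex : ∀ x y, 0 ≤ x → 0 ≤ y → f (x * y) ^ 2 ≤ f (x ^ 2) * f (y ^ 2)

namespace SuperMidconvex

variable {f : ℝ → ℝ}

lemma map_zero (hf : SuperMidconvex f) : f 0 = 0 := by
  have h1 := hf.nonneg 0 le_rfl
  have h2 := hf.superadd 0 0 le_rfl le_rfl
  rw [add_zero] at h2
  linarith

lemma sq_le_mul_div (hf : SuperMidconvex f) {a b : ℝ} (ha : 0 ≤ a) (hb : 0 ≤ b)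
    (hab : a = 0 → b = 0) : f b ^ 2 ≤ f a * f (b ^ 2 / a) := by
  rcases ha.eq_or_lt with rfl | ha
  · simp [hab rfl, hf.map_zero]
  · have h := hf.midconvex (√a) (b / √a) (by positivity) (by positivity)
    rwa [mul_div_cancel₀ _ (by positivity), div_pow, Real.sq_sqrt ha.le] at h

end SuperMidconvex

lemma Matrix.PosSemidef.sq_le_mul {n : Type*} [Fintype n] {A : Matrix n n ℝ}
    (hA : A.PosSemidef) (i j : n) : A i j ^ 2 ≤ A i i * A j j := by
  have h := (hA.submatrix ![i, j]).det_nonneg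
  have hs : A j i = A i j := by simpa using hA.isHermitian.apply i j
  rw [Matrix.det_fin_two] at h
  simp [hs] at h
  nlinarith

/-- Eliminating the row and column of the index `v` preserves positive semidefiniteness. -/
lemma Matrix.PosSemidef.eliminate {n : Type*} [Fintype n] [DecidableEq n] {A : Matrix n n ℝ}
    (hA : A.PosSemidef) (v : n) :
    (Matrix.of fun i j => A i j - A i v * A v j / A v v).PosSemidef := by
  by_cases ha : A v v = 0
  · have : (Matrix.of fun i j => A i j - A i v * A v j / A v v) = A := by
      ext i j; simp [ha]
    rwa [this]
  · have h := hA.conjTranspose_mul_mul_same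
      (1 - (A v v)⁻¹ • (Matrix.single v v (1 : ℝ) * A))
    convert h using 1
    have hE : (Matrix.single v v (1 : ℝ) * A * Matrix.single v v (1 : ℝ)) =
        A v v • Matrix.single v v (1 : ℝ) := by
      simp
    have hAt : Aᴴ = A := hA.isHermitian
    have key : (1 - (A v v)⁻¹ • (Matrix.single v v (1 : ℝ) * A))ᴴ * A *
        (1 - (A v v)⁻¹ • (Matrix.single v v (1 : ℝ) * A)) =
        A - (A v v)⁻¹ • (A * Matrix.single v v (1 : ℝ) * A) := by
      have h3 : A * Matrix.single v v (1 : ℝ) * A * (Matrix.single v v (1 : ℝ) * A) =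
          A v v • (A * Matrix.single v v (1 : ℝ) * A) := by
        calc _ = A * (Matrix.single v v (1 : ℝ) * A * Matrix.single v v (1 : ℝ)) * A := by
              simp only [Matrix.mul_assoc]
          _ = _ := by rw [hE, Matrix.mul_smul, Matrix.smul_mul]
      simp only [conjTranspose_sub, conjTranspose_one, conjTranspose_smul, conjTranspose_mul, hAt,
        Matrix.conjTranspose_single, star_trivial, sub_mul, mul_sub, one_mul, mul_one,
        Matrix.smul_mul, Matrix.mul_smul, h3, smul_smul]
      rw [inv_mul_cancel₀ ha, mul_one, ← Matrix.mul_assoc]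
      abel
    rw [key]
    ext i j
    simp only [of_apply, sub_apply, smul_apply, smul_eq_mul, Matrix.mul_assoc]
    rw [Matrix.mul_apply, Finset.sum_eq_single v]
    · simp [Matrix.single_mul_apply_same]; ring
    · intro b _ hb
      simp [Matrix.single_mul_apply_of_ne, hb]
    · simp

/-- The symmetric matrix supported on the rows and columns `u, v` is positive semidefinite if
its diagonal entries and its `2 × 2` minor are nonnegative. -/
lemma Matrix.posSemidef_pair {n : Type*} [Fintype n] [DecidableEq n] (u v : n)
    {p q r : ℝ} (hp : 0 ≤ p) (hr : 0 ≤ r) (h : q ^ 2 ≤ p * r) :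
    (Matrix.single v v p + Matrix.single v u q + Matrix.single u v q
      + Matrix.single u u r).PosSemidef := by
  refine .of_dotProduct_mulVec_nonneg ?_ fun x => ?_
  · simp only [IsHermitian, conjTranspose_add, Matrix.conjTranspose_single, star_trivial]
    abel
  · simp only [Matrix.add_mulVec, dotProduct_add, star_trivial]
    simp only [Matrix.single_mulVec_eq, dotProduct_smul, dotProduct_single, smul_eq_mul, mul_one]
    rcases hp.eq_or_lt with rfl | hp
    · have hq : q = 0 := by nlinarith
      subst hq
      nlinarith [mul_nonneg hr (sq_nonneg (x u))]
    · have : 0 ≤ p * (p * x v ^ 2 + 2 * q * x u * x v + r * x u ^ 2) := by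
        nlinarith [sq_nonneg (p * x v + q * x u), mul_nonneg (sub_nonneg.2 h) (sq_nonneg (x u))]
      have := nonneg_of_mul_nonneg_right this hp
      linarith

lemma SuperMidconvex.posSemidef_applyG {f : ℝ → ℝ} (hf : SuperMidconvex f) {n : ℕ}
    (G : SimpleGraph (Fin n)) (hG : G.IsAcyclic) (A : Matrix (Fin n) (Fin n) ℝ)
    (hA : memPG G (Set.Ici 0) A) : (applyG G f A).PosSemidef := by
  induction G using WellFoundedLT.induction generalizing A with
  | ind G ih =>
  obtain ⟨hpsd, hpos, hpat⟩ := hA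
  simp only [Set.mem_Ici] at hpos
  by_cases hbot : G = ⊥
  · have : applyG G f A = Matrix.diagonal fun i => f (A i i) := by
      ext i j
      by_cases hij : i = j
      · simp [applyG, hij]
      · simp [applyG, hij, hbot]
    rw [this]
    exact .diagonal fun i => hf.nonneg _ (hpos i i)
  obtain ⟨v, u, hvu, huniq⟩ := hG.exists_existsUnique_adj hbot
  simp only at huniq
  have hne : v ≠ u := hvu.ne
  have hs : ∀ i j, A i j = A j i := fun i j => by simpa using hpsd.isHermitian.apply j i
  have hsq := hpsd.sq_le_mul v u
  have hab : A v v = 0 → A v u = 0 := fun h => by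
    rw [h, zero_mul] at hsq
    nlinarith
  have hle : A v u ^ 2 / A v v ≤ A u u := by
    rcases (hpos v v).eq_or_lt with h | h
    · simpa [← h] using hpos u u
    · rw [div_le_iff₀ h]; linarith
  have hvz : ∀ i, i ≠ v → i ≠ u → A v i = 0 := fun i h1 h2 =>
    hpat v i h1.symm fun h => h2 (huniq i h)
  set B : Matrix (Fin n) (Fin n) ℝ := Matrix.of fun i j => A i j - A i v * A v j / A v v with hB
  have hBpsd : B.PosSemidef := hpsd.eliminate v
  have hBv : ∀ i, B v i = 0 := fun i => by
    rcases eq_or_ne (A v v) 0 with h | h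
    · have h2 := hpsd.sq_le_mul v i
      rw [h, zero_mul] at h2
      have : A v i = 0 := by nlinarith
      simp [hB, this]
    · simp [hB]; field_simp; simp
  have hBv' : ∀ i, B i v = 0 := fun i => by
    rw [← hBv i]; simpa using hBpsd.isHermitian.apply v i
  have hBu : B u u = A u u - A v u ^ 2 / A v v := by
    simp [hB, hs u v, sq]
  have hBe : ∀ i j, i ≠ v → j ≠ v → (i ≠ u ∨ j ≠ u) → B i j = A i j := by
    rintro i j hi hj (h | h)
    · simp [hB, hs i v, hvz i hi h]
    · simp [hB, hvz j hj h]
  set H := G.deleteEdges {s(v, u)} with hH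
  have hHG : H ≤ G := G.deleteEdges_le _
  have hHadj : ∀ i j, H.Adj i j ↔ G.Adj i j ∧ s(i, j) ≠ s(v, u) := fun i j => by simp [hH]
  have hlt : H < G := by
    refine lt_of_le_of_ne hHG fun h => ?_
    have := (hHadj v u).1 (h ▸ hvu)
    simp at this
  have hHv : ∀ i, ¬ H.Adj v i := fun i h => by
    rw [hHadj] at h
    exact h.2 (by rw [huniq i h.1])
  have hHv' : ∀ i, ¬ H.Adj i v := fun i h => hHv i h.symm
  have hHe : ∀ i j, i ≠ v → j ≠ v → (H.Adj i j ↔ G.Adj i j) := fun i j hi hj => by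
    simp [hHadj, hi, hj]
  have hBmem : memPG H (Set.Ici 0) B := by
    refine ⟨hBpsd, fun i j => ?_, fun i j hij hadj => ?_⟩
    · rw [Set.mem_Ici]
      by_cases hi : i = v
      · rw [hi, hBv]
      by_cases hj : j = v
      · rw [hj, hBv']
      by_cases h : i = u ∧ j = u
      · rw [h.1, h.2, hBu]; linarith
      · rw [hBe i j hi hj (by tauto)]; exact hpos i j
    · by_cases hi : i = v
      · rw [hi, hBv]
      by_cases hj : j = v
      · rw [hj, hBv']
      rw [hBe i j hi hj (by by_contra! h; exact hij (h.1.trans h.2.symm))]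
      exact hpat i j hij (by rwa [← hHe i j hi hj])
  have hind := ih H hlt (hG.anti hHG) B hBmem
  have hsub := hf.superadd (A u u - A v u ^ 2 / A v v) (A v u ^ 2 / A v v) (by linarith)
    (div_nonneg (sq_nonneg _) (hpos v v))
  rw [sub_add_cancel] at hsub
  have hdiv := hf.nonneg (A v u ^ 2 / A v v) (div_nonneg (sq_nonneg _) (hpos v v))
  have hfa := hf.nonneg _ (hpos v v)
  have hpair := Matrix.posSemidef_pair u v (p := f (A v v)) (q := f (A v u))
    (r := f (A u u) - f (A u u - A v u ^ 2 / A v v)) hfa (by linarith)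
    ((hf.sq_le_mul_div (hpos v v) (hpos v u) hab).trans
      (mul_le_mul_of_nonneg_left (by linarith) hfa))
  convert hind.add hpair using 1
  ext i j
  simp only [applyG, Matrix.add_apply, Matrix.of_apply, Matrix.single_apply]
  by_cases hi : i = v
  · subst hi
    by_cases hj : j = i
    · subst hj
      simp [hBv, hf.map_zero, hne.symm]
    · by_cases hju : j = u
      · subst hju
        simp [hHv, hne, hne.symm, hvu]
      · have : ¬ G.Adj i j := fun h => hju (huniq j h)
        simp [hHv, Ne.symm hj, Ne.symm hju, this, hne.symm]
  · by_cases hj : j = v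
    · subst hj
      by_cases hiu : i = u
      · subst hiu
        simp [hHv', hne, hne.symm, hvu.symm, hs i j]
      · have : ¬ G.Adj i j := fun h => hiu (huniq i h.symm)
        simp [hHv', hi, Ne.symm hi, Ne.symm hiu, this]
    · by_cases h : i = u ∧ j = u
      · obtain ⟨rfl, rfl⟩ := h
        simp [hBu, hne]
      · rw [hHe i j hi hj, hBe i j hi hj (by tauto)]
        have h' : ¬ (u = i ∧ u = j) := fun h2 => h ⟨h2.1.symm, h2.2.symm⟩
        simp [Ne.symm hi, Ne.symm hj, h']

lemma add_sq_le_add_mul_add {p q a b c d : ℝ} (ha : 0 ≤ a) (hb : 0 ≤ b) (hc : 0 ≤ c) (hd : 0 ≤ d)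
    (hp : p ^ 2 ≤ a * b) (hq : q ^ 2 ≤ c * d) : (p + q) ^ 2 ≤ (a + c) * (b + d) := by
  have h1 : (2 * (p * q)) ^ 2 ≤ (a * d + c * b) ^ 2 := by
    have := mul_le_mul hp hq (sq_nonneg q) (mul_nonneg ha hb)
    nlinarith [sq_nonneg (a * d - c * b)]
  have h2 : 2 * (p * q) ≤ a * d + c * b :=
    le_of_sq_le_sq h1 (by positivity)
  nlinarith

namespace SuperMidconvex

variable {f g : ℝ → ℝ}

lemma zero : SuperMidconvex fun _ => 0 where
  nonneg _ _ := le_rfl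
  superadd _ _ _ _ := by simp
  midconvex _ _ _ _ := by simp

lemma add (hf : SuperMidconvex f) (hg : SuperMidconvex g) :
    SuperMidconvex fun x => f x + g x where
  nonneg x hx := add_nonneg (hf.nonneg x hx) (hg.nonneg x hx)
  superadd x y hx hy := by
    have h1 := hf.superadd x y hx hy
    have h2 := hg.superadd x y hx hy
    linarith
  midconvex x y hx hy := by
    apply add_sq_le_add_mul_add <;>
      first
      | exact hf.midconvex x y hx hy
      | exact hg.midconvex x y hx hy
      | exact hf.nonneg _ (sq_nonneg _)
      | exact hg.nonneg _ (sq_nonneg _)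

lemma of_tendsto {F : ℕ → ℝ → ℝ} (hF : ∀ k, SuperMidconvex (F k))
    (h : ∀ x, Filter.Tendsto (fun k => F k x) Filter.atTop (nhds (f x))) : SuperMidconvex f where
  nonneg x hx := ge_of_tendsto' (h x) fun k => (hF k).nonneg x hx
  superadd x y hx hy :=
    le_of_tendsto_of_tendsto' ((h x).add (h y)) (h _) fun k => (hF k).superadd x y hx hy
  midconvex x y hx hy :=
    le_of_tendsto_of_tendsto' ((h _).pow 2) ((h _).mul (h _)) fun k => (hF k).midconvex x y hx hy

/-- A nonnegative monotone multiplicatively midconvex function becomes superadditive after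
multiplication by a positive power. -/
lemma const_mul_pow_succ_mul {q : ℝ → ℝ} {c : ℝ} (hc : 0 ≤ c) (k : ℕ)
    (h0 : ∀ x, 0 ≤ x → 0 ≤ q x) (hmono : ∀ x y, 0 ≤ x → x ≤ y → q x ≤ q y)
    (hmid : ∀ x y, 0 ≤ x → 0 ≤ y → q (x * y) ^ 2 ≤ q (x ^ 2) * q (y ^ 2)) :
    SuperMidconvex fun x => c * (x ^ (k + 1) * q x) where
  nonneg x hx := mul_nonneg hc (mul_nonneg (pow_nonneg hx _) (h0 x hx))
  superadd x y hx hy := by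
    have key : ∀ x z, 0 ≤ x → x ≤ z → x ^ k * q x ≤ z ^ k * q z := fun x z hx hxz =>
      mul_le_mul (pow_le_pow_left₀ hx hxz k) (hmono x z hx hxz) (h0 x hx)
        (pow_nonneg (hx.trans hxz) k)
    have h1 := mul_le_mul_of_nonneg_left (key x (x + y) hx (by linarith)) hx
    have h2 := mul_le_mul_of_nonneg_left (key y (x + y) hy (by linarith)) hy
    rw [← mul_add]
    refine mul_le_mul_of_nonneg_left ?_ hc
    calc x ^ (k + 1) * q x + y ^ (k + 1) * q y
        = x * (x ^ k * q x) + y * (y ^ k * q y) := by ring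
      _ ≤ x * ((x + y) ^ k * q (x + y)) + y * ((x + y) ^ k * q (x + y)) := add_le_add h1 h2
      _ = _ := by ring
  midconvex x y hx hy := by
    have := mul_le_mul_of_nonneg_left (hmid x y hx hy)
      (sq_nonneg (c * (x ^ (k + 1) * y ^ (k + 1))))
    calc _ = (c * (x ^ (k + 1) * y ^ (k + 1))) ^ 2 * q (x * y) ^ 2 := by
          rw [mul_pow x y]; ring
      _ ≤ _ := this
      _ = _ := by ring

end SuperMidconvex

section PowerDifferences

variable {x y : ℝ}

lemma pow_sub_pow_le_of_le_one (hx : 0 ≤ x) (hxy : x ≤ y) (hy : y ≤ 1) (d : ℕ) :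
    y ^ d - x ^ d ≤ d * (y - x) := by
  induction d with
  | zero => simp
  | succ d ih =>
    have hx1 : x ^ d ≤ 1 := pow_le_one₀ hx (hxy.trans hy)
    have h0 : 0 ≤ y ^ d - x ^ d := sub_nonneg.2 (pow_le_pow_left₀ hx hxy d)
    have h1 : y * (y ^ d - x ^ d) ≤ y ^ d - x ^ d := mul_le_of_le_one_left h0 hy
    have h2 : x ^ d * (y - x) ≤ y - x := mul_le_of_le_one_left (by linarith) hx1
    push_cast
    calc y ^ (d + 1) - x ^ (d + 1) = y * (y ^ d - x ^ d) + x ^ d * (y - x) := by ring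
      _ ≤ _ := by linarith

lemma pow_sub_pow_le_of_one_le (hx : 1 ≤ x) (hxy : x ≤ y) (d : ℕ) :
    y ^ (d + 1) - x ^ (d + 1) ≤ (d + 1) * ((x * y) ^ d * (y - x)) := by
  have hy : 1 ≤ y := hx.trans hxy
  induction d with
  | zero => simp
  | succ d ih =>
    have h0 : 0 ≤ (x * y) ^ d * (y - x) := mul_nonneg (by positivity) (by linarith)
    have h1 : y * (y ^ (d + 1) - x ^ (d + 1)) ≤ (d + 1) * ((x * y) ^ (d + 1) * (y - x)) := by
      calc y * (y ^ (d + 1) - x ^ (d + 1)) ≤ y * ((d + 1) * ((x * y) ^ d * (y - x))) :=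
            mul_le_mul_of_nonneg_left ih (by linarith)
        _ ≤ x * (y * ((d + 1) * ((x * y) ^ d * (y - x)))) :=
            le_mul_of_one_le_left (by positivity) hx
        _ = _ := by ring
    have h2 : x ^ (d + 1) * (y - x) ≤ (x * y) ^ (d + 1) * (y - x) := by
      refine mul_le_mul_of_nonneg_right ?_ (by linarith)
      rw [mul_pow]
      exact le_mul_of_one_le_right (by positivity) (one_le_pow₀ hy)
    push_cast
    calc y ^ (d + 1 + 1) - x ^ (d + 1 + 1)
        = y * (y ^ (d + 1) - x ^ (d + 1)) + x ^ (d + 1) * (y - x) := by ring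
      _ ≤ _ := by linarith

lemma pow_sub_pow_mono_exponent (hx : 0 ≤ x) (hxy : x ≤ y) (hy : 1 ≤ y) :
    Monotone fun d : ℕ => y ^ d - x ^ d := by
  refine monotone_nat_of_le_succ fun d => ?_
  have h0 : x ^ d ≤ y ^ d := pow_le_pow_left₀ hx hxy d
  have h1 : x ^ d * (x - 1) ≤ y ^ d * (y - 1) := by
    rcases le_total x 1 with h | h
    · exact (mul_nonpos_of_nonneg_of_nonpos (by positivity) (by linarith)).trans
        (mul_nonneg (by positivity) (by linarith))
    · exact mul_le_mul h0 (by linarith) (by linarith) (by positivity)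
  rw [pow_succ, pow_succ]
  linarith

lemma mul_pow_mul_pow_sub_pow_le (hx : 0 ≤ x) (hxy : x ≤ y) (hx1 : x ≤ 1) (d e : ℕ) :
    (x * y) ^ e * (y ^ d - x ^ d) ≤ y ^ (e + d) - x ^ (e + d) := by
  have hy : 0 ≤ y := hx.trans hxy
  induction e with
  | zero => simp
  | succ e ih =>
    have h0 : x ^ (e + d + 1) ≤ y ^ (e + d + 1) := pow_le_pow_left₀ hx hxy _
    have h1 : x ^ (e + d + 1) * (1 - y) ≤ y ^ (e + d + 1) * (1 - x) := by
      rcases le_total y 1 with h | h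
      · exact mul_le_mul h0 (by linarith) (by linarith) (by positivity)
      · exact (mul_nonpos_of_nonneg_of_nonpos (by positivity) (by linarith)).trans
          (mul_nonneg (by positivity) (by linarith))
    calc (x * y) ^ (e + 1) * (y ^ d - x ^ d) = x * y * ((x * y) ^ e * (y ^ d - x ^ d)) := by ring
      _ ≤ x * y * (y ^ (e + d) - x ^ (e + d)) := mul_le_mul_of_nonneg_left ih (by positivity)
      _ = x * y ^ (e + d + 1) - y * x ^ (e + d + 1) := by ring
      _ ≤ y ^ (e + d + 1) - x ^ (e + d + 1) := by linarith
      _ = _ := by rw [add_right_comm]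

lemma pow_sub_pow_le_add (hx : 0 ≤ x) (hxy : x ≤ y) {j k : ℕ} (hjk : j ≤ k) :
    y ^ j - x ^ j ≤ k * ((y - x) + (y ^ k - x ^ k)) := by
  have hk0 : 0 ≤ y ^ k - x ^ k := sub_nonneg.2 (pow_le_pow_left₀ hx hxy k)
  have hd : 0 ≤ y - x := sub_nonneg.2 hxy
  rcases le_total y 1 with h | h
  · calc _ ≤ j * (y - x) := pow_sub_pow_le_of_le_one hx hxy h j
      _ ≤ k * (y - x) := mul_le_mul_of_nonneg_right (by exact_mod_cast hjk) hd
      _ ≤ _ := mul_le_mul_of_nonneg_left (by linarith) (by positivity)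
  · rcases Nat.eq_zero_or_pos k with rfl | hk
    · simp [Nat.le_zero.1 hjk]
    · have : (1 : ℝ) ≤ k := by exact_mod_cast hk
      calc _ ≤ y ^ k - x ^ k := pow_sub_pow_mono_exponent hx hxy h hjk
        _ ≤ (y - x) + (y ^ k - x ^ k) := by linarith
        _ ≤ _ := le_mul_of_one_le_left (by linarith) this

end PowerDifferences

/-- The two lowest and the two highest monomials of a polynomial of degree `l + 3`. -/
def endTerms (l : ℕ) (x : ℝ) : ℝ := 1 + x + x ^ (l + 2) + x ^ (l + 3)

/-- The monomials strictly between those of `endTerms l`. -/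
def midTerms (l : ℕ) (x : ℝ) : ℝ := ∑ i ∈ Finset.range l, x ^ (i + 2)

/-- The size of the negative coefficients in a block of length `l + 4`. -/
noncomputable def blockEps (l : ℕ) : ℝ := 1 / (4 * (l + 3) ^ 3)

/-- A polynomial of degree `l + 3` whose coefficients are negative except for the two lowest and
the two highest ones. -/
noncomputable def blockPoly (l : ℕ) (x : ℝ) : ℝ := endTerms l x - blockEps l * midTerms l x

/-- The deficit in the multiplicative midconvexity of `endTerms l`. -/
def endDeficit (l : ℕ) (x y : ℝ) : ℝ :=
  endTerms l (x ^ 2) * endTerms l (y ^ 2) - endTerms l (x * y) ^ 2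

lemma endDeficit_eq (l : ℕ) (x y : ℝ) : endDeficit l x y =
    (y - x) ^ 2 + (y ^ (l + 2) - x ^ (l + 2)) ^ 2 + (y ^ (l + 3) - x ^ (l + 3)) ^ 2
      + (x * y * (y ^ (l + 1) - x ^ (l + 1))) ^ 2 + (x * y * (y ^ (l + 2) - x ^ (l + 2))) ^ 2
      + ((x * y) ^ (l + 2) * (y - x)) ^ 2 := by
  simp only [endDeficit, endTerms]
  ring

lemma endTerms_cross_le {x y : ℝ} (hx : 0 ≤ x) (hxy : x ≤ y) (i d : ℕ) :
    endTerms (i + d + 1) (x ^ 2) * (y ^ 2) ^ (i + 2) + (x ^ 2) ^ (i + 2) *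
      endTerms (i + d + 1) (y ^ 2) - 2 * (endTerms (i + d + 1) (x * y) * (x * y) ^ (i + 2)) ≤
    4 * ((i + d + 1 : ℕ) + 3) ^ 2 * endDeficit (i + d + 1) x y := by
  have hy : 0 ≤ y := hx.trans hxy
  have hd : 0 ≤ y - x := sub_nonneg.2 hxy
  have hp : ∀ k : ℕ, 0 ≤ y ^ k - x ^ k := fun k => sub_nonneg.2 (pow_le_pow_left₀ hx hxy k)
  set M : ℝ := ((i + d + 1 : ℕ) : ℝ) + 3 with hM
  have hM' : M = i + d + 4 := by rw [hM]; push_cast; ring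
  have hi : (0 : ℝ) ≤ i := i.cast_nonneg
  have hdn : (0 : ℝ) ≤ d := d.cast_nonneg
  have hM1 : 1 ≤ M := by linarith
  have hM0 : 0 ≤ M := by linarith
  set T := endDeficit (i + d + 1) x y with hT
  have hTeq := endDeficit_eq (i + d + 1) x y
  rw [← hT] at hTeq
  have step : ∀ E e : ℝ, 0 ≤ E → E ≤ M * e → e ^ 2 ≤ T → E ^ 2 ≤ M ^ 2 * T := fun E e h0 h1 h2 =>
    calc E ^ 2 ≤ (M * e) ^ 2 := pow_le_pow_left₀ h0 h1 2
      _ = M ^ 2 * e ^ 2 := by ring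
      _ ≤ _ := mul_le_mul_of_nonneg_left h2 (sq_nonneg M)
  have key : ∀ a b c e f g : ℝ, T = a ^ 2 + b ^ 2 + c ^ 2 + e ^ 2 + f ^ 2 + g ^ 2 →
      a ^ 2 ≤ T ∧ b ^ 2 ≤ T ∧ c ^ 2 ≤ T ∧ e ^ 2 ≤ T ∧ f ^ 2 ≤ T ∧ g ^ 2 ≤ T := by
    intro a b c e f g h
    have := sq_nonneg a
    have := sq_nonneg b
    have := sq_nonneg c
    have := sq_nonneg e
    have := sq_nonneg f
    have := sq_nonneg g
    refine ⟨?_, ?_, ?_, ?_, ?_, ?_⟩ <;> linarith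
  obtain ⟨t1, t2, t3, t4, t5, t6⟩ := key _ _ _ _ _ _ hTeq
  have e0 : (y ^ (i + 2) - x ^ (i + 2)) ^ 2 ≤ M ^ 2 * T := by
    rcases le_total y 1 with h | h
    · refine step _ _ (hp _) ((pow_sub_pow_le_of_le_one hx hxy h _).trans ?_) t1
      refine mul_le_mul_of_nonneg_right ?_ hd
      push_cast
      linarith
    · refine step _ _ (hp _) ?_ t3
      exact (pow_sub_pow_mono_exponent hx hxy h (by omega)).trans
        (le_mul_of_one_le_left (hp _) hM1)
  have e1 : (x * y * (y ^ (i + 1) - x ^ (i + 1))) ^ 2 ≤ M ^ 2 * T := by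
    have h0 : 0 ≤ x * y * (y ^ (i + 1) - x ^ (i + 1)) := mul_nonneg (by positivity) (hp _)
    rcases le_total y 1 with h | h
    · refine step _ _ h0 ((mul_le_of_le_one_left (hp _)
        (mul_le_one₀ (hxy.trans h) hy h)).trans
        ((pow_sub_pow_le_of_le_one hx hxy h _).trans ?_)) t1
      refine mul_le_mul_of_nonneg_right ?_ hd
      push_cast
      linarith
    · refine step _ _ h0 ?_ t5
      exact (mul_le_mul_of_nonneg_left (pow_sub_pow_mono_exponent hx hxy h (by omega))
        (by positivity)).trans (le_mul_of_one_le_left (mul_nonneg (by positivity) (hp _)) hM1)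
  have e2 : ((x * y) ^ (i + 2) * (y ^ (d + 1) - x ^ (d + 1))) ^ 2 ≤ M ^ 2 * T := by
    have h0 : 0 ≤ (x * y) ^ (i + 2) * (y ^ (d + 1) - x ^ (d + 1)) :=
      mul_nonneg (by positivity) (hp _)
    rcases le_total x 1 with h | h
    · refine step _ _ h0 ?_ t2
      refine (mul_pow_mul_pow_sub_pow_le hx hxy h _ _).trans (le_trans (le_of_eq ?_)
        (le_mul_of_one_le_left (hp _) hM1))
      rw [show i + 2 + (d + 1) = i + d + 1 + 2 by ring]
    · have hxy1 : 1 ≤ x * y := one_le_mul_of_one_le_of_one_le h (h.trans hxy)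
      refine step _ _ h0 ?_ t6
      calc _ ≤ (x * y) ^ (i + 2) * ((d + 1) * ((x * y) ^ d * (y - x))) :=
            mul_le_mul_of_nonneg_left (pow_sub_pow_le_of_one_le h hxy d) (by positivity)
        _ = (d + 1) * ((x * y) ^ (i + d + 2) * (y - x)) := by ring
        _ ≤ M * ((x * y) ^ (i + d + 1 + 2) * (y - x)) := by
          refine mul_le_mul (by linarith) (mul_le_mul_of_nonneg_right
            (pow_le_pow_right₀ hxy1 (by omega)) hd) (mul_nonneg (by positivity) hd) hM0
  have e3 : ((x * y) ^ (i + 2) * (y ^ (d + 2) - x ^ (d + 2))) ^ 2 ≤ M ^ 2 * T := by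
    have h0 : 0 ≤ (x * y) ^ (i + 2) * (y ^ (d + 2) - x ^ (d + 2)) :=
      mul_nonneg (by positivity) (hp _)
    rcases le_total x 1 with h | h
    · refine step _ _ h0 ?_ t3
      refine (mul_pow_mul_pow_sub_pow_le hx hxy h _ _).trans (le_trans (le_of_eq ?_)
        (le_mul_of_one_le_left (hp _) hM1))
      rw [show i + 2 + (d + 2) = i + d + 1 + 3 by ring]
    · refine step _ _ h0 ?_ t6
      calc _ ≤ (x * y) ^ (i + 2) * (((d + 1 : ℕ) + 1) * ((x * y) ^ (d + 1) * (y - x))) :=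
            mul_le_mul_of_nonneg_left (pow_sub_pow_le_of_one_le h hxy (d + 1)) (by positivity)
        _ = ((d + 1 : ℕ) + 1) * ((x * y) ^ (i + d + 1 + 2) * (y - x)) := by ring
        _ ≤ M * ((x * y) ^ (i + d + 1 + 2) * (y - x)) := by
          refine mul_le_mul_of_nonneg_right ?_ (mul_nonneg (by positivity) hd)
          push_cast
          linarith
  calc _ = (y ^ (i + 2) - x ^ (i + 2)) ^ 2 + (x * y * (y ^ (i + 1) - x ^ (i + 1))) ^ 2
        + ((x * y) ^ (i + 2) * (y ^ (d + 1) - x ^ (d + 1))) ^ 2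
        + ((x * y) ^ (i + 2) * (y ^ (d + 2) - x ^ (d + 2))) ^ 2 := by
        simp only [endTerms]
        ring
    _ ≤ _ := by linarith

lemma blockEps_mul_le (l : ℕ) {k : ℝ} (hk : k ≤ 4 * (l + 3) ^ 3) : blockEps l * k ≤ 1 := by
  rw [blockEps, one_div, inv_mul_le_iff₀ (by positivity)]
  linarith

lemma blockEps_pos (l : ℕ) : 0 < blockEps l := by
  unfold blockEps
  positivity

lemma blockPoly_mono {x y : ℝ} (l : ℕ) (hx : 0 ≤ x) (hxy : x ≤ y) :
    blockPoly l x ≤ blockPoly l y := by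
  have hp : ∀ k : ℕ, 0 ≤ y ^ k - x ^ k := fun k => sub_nonneg.2 (pow_le_pow_left₀ hx hxy k)
  set S := (y - x) + (y ^ (l + 3) - x ^ (l + 3)) with hS
  have hS0 : 0 ≤ S := add_nonneg (sub_nonneg.2 hxy) (hp _)
  have hmid : midTerms l y - midTerms l x ≤ l * ((l + 3) * S) := by
    rw [midTerms, midTerms, ← Finset.sum_sub_distrib]
    refine (Finset.sum_le_card_nsmul _ _ ((l + 3) * S) fun i hi => ?_).trans (by simp)
    rw [Finset.mem_range] at hi
    simpa using pow_sub_pow_le_add hx hxy (show i + 2 ≤ l + 3 by omega)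
  have h1 := mul_le_mul_of_nonneg_left hmid (blockEps_pos l).le
  have h2 : blockEps l * (l * (l + 3)) ≤ 1 := blockEps_mul_le l (by
    have : (0 : ℝ) ≤ l := l.cast_nonneg
    nlinarith [mul_nonneg this this, mul_nonneg (mul_nonneg this this) this])
  have h3 := mul_le_mul_of_nonneg_right h2 hS0
  have h4 : S ≤ endTerms l y - endTerms l x := by
    have := hp (l + 2)
    simp only [endTerms]
    linarith
  simp only [blockPoly]
  nlinarith

lemma blockPoly_nonneg {x : ℝ} (l : ℕ) (hx : 0 ≤ x) : 0 ≤ blockPoly l x := by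
  refine le_trans ?_ (blockPoly_mono l le_rfl hx)
  simp [blockPoly, endTerms, midTerms]

lemma blockPoly_midconvex {x y : ℝ} (l : ℕ) (hx : 0 ≤ x) (hy : 0 ≤ y) :
    blockPoly l (x * y) ^ 2 ≤ blockPoly l (x ^ 2) * blockPoly l (y ^ 2) := by
  wlog hxy : x ≤ y generalizing x y
  · rw [mul_comm x, mul_comm (blockPoly l (x ^ 2))]
    exact this hy hx (le_of_not_ge hxy)
  set T := endDeficit l x y with hT
  have hT0 : 0 ≤ T := by rw [hT, endDeficit_eq]; positivity
  have hcross : endTerms l (x ^ 2) * midTerms l (y ^ 2) + midTerms l (x ^ 2) * endTerms l (y ^ 2)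
      - 2 * (endTerms l (x * y) * midTerms l (x * y)) ≤ l * (4 * (l + 3) ^ 2 * T) := by
    simp only [midTerms, Finset.mul_sum, Finset.sum_mul]
    rw [← Finset.sum_add_distrib, ← Finset.sum_sub_distrib]
    refine (Finset.sum_le_card_nsmul _ _ (4 * (l + 3) ^ 2 * T) fun i hi => ?_).trans (by simp)
    obtain ⟨d, rfl⟩ := Nat.exists_eq_add_of_lt (Finset.mem_range.1 hi)
    exact endTerms_cross_le hx hxy i d
  have hmid : midTerms l (x * y) ^ 2 ≤ midTerms l (x ^ 2) * midTerms l (y ^ 2) := by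
    simp only [midTerms, mul_pow]
    refine (Finset.sum_mul_sq_le_sq_mul_sq _ _ _).trans (le_of_eq ?_)
    simp only [← pow_mul, mul_comm]
  have h1 := mul_le_mul_of_nonneg_left hcross (blockEps_pos l).le
  have h2 : blockEps l * (l * (4 * (l + 3) ^ 2)) ≤ 1 := blockEps_mul_le l (by
    have : (0 : ℝ) ≤ l := l.cast_nonneg
    nlinarith [sq_nonneg ((l : ℝ) + 3)])
  have h3 := mul_le_mul_of_nonneg_right h2 hT0
  have h4 := mul_le_mul_of_nonneg_left hmid (sq_nonneg (blockEps l))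
  have h5 : T = endTerms l (x ^ 2) * endTerms l (y ^ 2) - endTerms l (x * y) ^ 2 := hT
  simp only [blockPoly]
  linarith

lemma superMidconvex_blockPoly {c : ℝ} (hc : 0 ≤ c) (k l : ℕ) :
    SuperMidconvex fun x => c * (x ^ (k + 1) * blockPoly l x) :=
  .const_mul_pow_succ_mul hc k (fun _ => blockPoly_nonneg l) (fun _ _ => blockPoly_mono l)
    fun _ _ => blockPoly_midconvex l

/-- The coefficients of `blockPoly l`. -/
noncomputable def blockCoeff (l i : ℕ) : ℝ := if i < 2 ∨ l + 2 ≤ i then 1 else -blockEps l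

lemma sum_blockCoeff (l : ℕ) (x : ℝ) :
    ∑ i ∈ Finset.range (l + 4), blockCoeff l i * x ^ i = blockPoly l x := by
  have h : ∀ i ∈ Finset.range l, blockCoeff l (i + 1 + 1) * x ^ (i + 1 + 1)
      = -blockEps l * x ^ (i + 2) := fun i hi => by
    rw [blockCoeff, if_neg]
    have := Finset.mem_range.1 hi
    omega
  rw [Finset.sum_range_succ, Finset.sum_range_succ, Finset.sum_range_succ', Finset.sum_range_succ',
    Finset.sum_congr rfl h, ← Finset.mul_sum]
  simp [blockCoeff, blockPoly, endTerms, midTerms]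
  ring

lemma abs_blockCoeff_le_one (l i : ℕ) : |blockCoeff l i| ≤ 1 := by
  unfold blockCoeff
  split_ifs
  · simp
  · rw [abs_neg, abs_of_pos (blockEps_pos l)]
    simpa using blockEps_mul_le l (k := 1) (by
      have : (0 : ℝ) ≤ l := l.cast_nonneg
      nlinarith [mul_nonneg this this, mul_nonneg (mul_nonneg this this) this])

/-- Coefficients arranged in dyadic blocks `[2 ^ k, 2 ^ (k + 1))`, each of them a positive
multiple of the coefficients of a polynomial `blockPoly l`. -/
noncomputable def dyadicCoeff (n : ℕ) : ℝ :=
  if n < 4 then 0 else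
    1 / ((2 ^ (Nat.log 2 n + 1)).factorial : ℝ) *
      blockCoeff (2 ^ Nat.log 2 n - 4) (n - 2 ^ Nat.log 2 n)

lemma abs_dyadicCoeff_le (n : ℕ) : |dyadicCoeff n| ≤ 1 / (n.factorial : ℝ) := by
  unfold dyadicCoeff
  split_ifs
  · rw [abs_zero]; positivity
  · rw [abs_mul, abs_of_pos (by positivity)]
    refine (mul_le_of_le_one_right (by positivity) (abs_blockCoeff_le_one _ _)).trans ?_
    refine one_div_le_one_div_of_le (by positivity) ?_
    exact_mod_cast Nat.factorial_le (Nat.lt_pow_succ_log_self one_lt_two n).le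

lemma dyadicCoeff_two_pow_add {k i : ℕ} (hk : 2 ≤ k) (hi : i < 2 ^ k) :
    dyadicCoeff (2 ^ k + i) =
      1 / ((2 ^ (k + 1)).factorial : ℝ) * blockCoeff (2 ^ k - 4) i := by
  have h4 : 2 ^ 2 ≤ 2 ^ k := Nat.pow_le_pow_right two_pos hk
  have hlog : Nat.log 2 (2 ^ k + i) = k := by
    rw [Nat.log_eq_iff (by omega)]
    exact ⟨by omega, by rw [pow_succ]; omega⟩
  rw [dyadicCoeff, if_neg (by omega), hlog, Nat.add_sub_cancel_left]

lemma summable_dyadicCoeff (x : ℝ) : Summable fun n => dyadicCoeff n * x ^ n := by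
  refine .of_norm_bounded (Real.summable_pow_div_factorial |x|) fun n => ?_
  rw [norm_mul, norm_pow, Real.norm_eq_abs, Real.norm_eq_abs, div_eq_mul_one_div, mul_comm]
  exact mul_le_mul_of_nonneg_left (abs_dyadicCoeff_le n) (by positivity)

lemma superMidconvex_sum_dyadicCoeff (k : ℕ) :
    SuperMidconvex fun x => ∑ n ∈ Finset.range (2 ^ (k + 2)), dyadicCoeff n * x ^ n := by
  induction k with
  | zero =>
    convert SuperMidconvex.zero using 2 with x
    refine Finset.sum_eq_zero fun n hn => ?_
    rw [Finset.mem_range] at hn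
    simp [dyadicCoeff, show n < 4 by simpa using hn]
  | succ k ih =>
    have h4 : 4 ≤ 2 ^ (k + 2) := Nat.pow_le_pow_right (i := 2) two_pos (by omega : 2 ≤ k + 2)
    convert ih.add (superMidconvex_blockPoly (c := 1 / ((2 ^ (k + 2 + 1)).factorial : ℝ))
      (by positivity) (2 ^ (k + 2) - 1) (2 ^ (k + 2) - 4)) using 2 with x
    have hr : Finset.range (2 ^ (k + 1 + 2)) = Finset.range (2 ^ (k + 2) + 2 ^ (k + 2)) := by
      congr 1; ring
    rw [hr, Finset.sum_range_add,
      ← sum_blockCoeff, Nat.sub_add_cancel (by omega), Nat.sub_add_cancel h4, Finset.mul_sum,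
      Finset.mul_sum]
    congr 1
    refine Finset.sum_congr rfl fun i hi => ?_
    rw [dyadicCoeff_two_pow_add (by omega) (Finset.mem_range.1 hi), pow_add]
    ring

lemma superMidconvex_tsum_dyadicCoeff :
    SuperMidconvex fun x => ∑' n : ℕ, dyadicCoeff n * x ^ n := by
  refine .of_tendsto superMidconvex_sum_dyadicCoeff fun x => ?_
  exact (summable_dyadicCoeff x).hasSum.tendsto_sum_nat.comp
    ((tendsto_pow_atTop_atTop_of_one_lt one_lt_two).comp (Filter.tendsto_add_atTop_nat 2))

lemma SuperMidconvex.memPG_applyG {f : ℝ → ℝ} (hf : SuperMidconvex f) {n : ℕ}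
    {G : SimpleGraph (Fin n)} (hG : G.IsAcyclic) {A : Matrix (Fin n) (Fin n) ℝ}
    (hA : memPG G (Set.Ici 0) A) : memPG G Set.univ (applyG G f A) :=
  ⟨hf.posSemidef_applyG G hG A hA, fun _ _ => Set.mem_univ _,
    fun i j hij hadj => by simp [applyG, hij, hadj]⟩

theorem stmt1 :
    ∃ a : ℕ → ℝ,
      (∀ x : ℝ, Summable fun k => a k * x ^ k) ∧
      (∀ k : ℕ, a k ∈ Set.Icc (-1 : ℝ) 1) ∧
      (∀ m : ℕ, 1 ≤ m → ∃ N : ℕ, ∀ i < m, a (N + i) < 0) ∧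
      (∀ (n : ℕ) (G : SimpleGraph (Fin n)), G.IsTree →
        ∀ A : Matrix (Fin n) (Fin n) ℝ, memPG G (Set.Ici 0) A →
          memPG G Set.univ (applyG G (fun x => ∑' k : ℕ, a k * x ^ k) A)) := by
  refine ⟨dyadicCoeff, summable_dyadicCoeff, fun k => ?_, fun m _ => ?_, fun n G hG A hA =>
    superMidconvex_tsum_dyadicCoeff.memPG_applyG hG.isAcyclic hA⟩
  · refine abs_le.1 ((abs_dyadicCoeff_le k).trans ?_)
    exact div_le_one_of_le₀ (by exact_mod_cast k.factorial_pos) (by positivity)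
  · have hm : m + 4 < 2 ^ (m + 4) := Nat.lt_two_pow_self
    refine ⟨2 ^ (m + 4) + 2, fun i hi => ?_⟩
    rw [add_assoc, dyadicCoeff_two_pow_add (by omega) (by omega), blockCoeff, if_neg (by omega)]
    exact mul_neg_of_pos_of_neg (by positivity) (neg_neg_of_pos (blockEps_pos _))
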